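/- Let φ ∈ OB and let the metric have the product (component-wise) form, induced by the operator G^×_φ v = (G^×_{φ,1}v₁,…,G^×_{φ,p}v_p) with each G^×_{φ,j} inducing a symmetric, bounded, coercive bilinear form on H¹₀(Ω). Then the g^×_φ-orthogonal projection onto T_φOB is given explicitly by P^×_φ(u) = u − (G^×_φ)⁻¹(φ Σ^×_{φ,u}) with the diagonal matrix Σ^×_{φ,u} = ⟪φ, (G^×_φ)⁻¹φ⟫⁻¹ ⟪φ, u⟫. -/

import Mathlib

noncomputable section

/-- A coercive bilinear form is definite. -/
theorem eq_zero_of_coercive {E : Type*} [NormedAddCommGroup E] [NormedSpace ℝ E]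
    {g : E →ₗ[ℝ] E →ₗ[ℝ] ℝ} (hg : ∃ c : ℝ, 0 < c ∧ ∀ u, c * ‖u‖ ^ 2 ≤ g u u)
    {x : E} (hx : g x x = 0) : x = 0 := by
  obtain ⟨c, hc, h⟩ := hg
  have hle : c * ‖x‖ ^ 2 ≤ c * 0 := by simpa [hx] using h x
  have hsq : ‖x‖ ^ 2 = 0 := le_antisymm (le_of_mul_le_mul_left hle hc) (sq_nonneg _)
  exact norm_eq_zero.mp (pow_eq_zero_iff two_ne_zero |>.mp hsq)

/-- The solution operator of a coercive form is homogeneous. -/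
theorem solution_smul_of_coercive {E : Type*} [NormedAddCommGroup E] [NormedSpace ℝ E]
    {g b : E →ₗ[ℝ] E →ₗ[ℝ] ℝ} (hg : ∃ c : ℝ, 0 < c ∧ ∀ u, c * ‖u‖ ^ 2 ≤ g u u)
    {Q : E → E} (hQ : ∀ v z, g (Q v) z = b v z) (a : ℝ) (v : E) :
    Q (a • v) = a • Q v := by
  refine sub_eq_zero.mp (eq_zero_of_coercive hg ?_)
  rw [LinearMap.map_sub₂, LinearMap.map_smul₂, hQ, hQ, LinearMap.map_smul₂, sub_self]

/-- The solution operator of a coercive form satisfies `b v (Q v) ≠ 0` whenever `b v v ≠ 0`. -/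
theorem pairing_solution_ne_zero {E : Type*} [NormedAddCommGroup E] [NormedSpace ℝ E]
    {g b : E →ₗ[ℝ] E →ₗ[ℝ] ℝ} (hg : ∃ c : ℝ, 0 < c ∧ ∀ u, c * ‖u‖ ^ 2 ≤ g u u)
    {Q : E → E} (hQ : ∀ v z, g (Q v) z = b v z) {v : E} (hv : b v v ≠ 0) :
    b v (Q v) ≠ 0 := by
  intro h
  have hQv : Q v = 0 := eq_zero_of_coercive hg ((hQ v (Q v)).trans h)
  exact hv (by rw [← hQ, hQv, map_zero, LinearMap.zero_apply])

/-- Corollary 4.4, projection for product metrics. Abstract setting: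
`H0` models `H¹₀(Ω)`, `H = Fin p → H0` models `[H¹₀(Ω)]^p`, `b` is the `L²`-pairing.
The product metric is induced by component operators `G^×_{φ,j}` with symmetric,
bounded, coercive bilinear forms `gj j`, whose inverses (applied to `L²`-functionals) are
encoded by `Qj j`, i.e. `gj j (Qj j v) z = b v z` for all `z`. Then the `g^×_φ`-orthogonal
projection onto `T_φOB` is `P^×_φ(u) = u − (G^×_φ)⁻¹(φ Σ^×_{φ,u})` with
`Σ^×_{φ,u} = ⟪φ, (G^×_φ)⁻¹φ⟫⁻¹ ⟪φ, u⟫`: it maps into the tangent space, its complement is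
`g^×_φ`-orthogonal to the tangent space, and it is idempotent. -/
theorem product_metric_projection
    {H0 : Type*} [NormedAddCommGroup H0] [InnerProductSpace ℝ H0] [CompleteSpace H0]
    {p : ℕ} (hp : 1 ≤ p)
    (b : H0 →ₗ[ℝ] H0 →ₗ[ℝ] ℝ)
    (hbsymm : ∀ u v, b u v = b v u)
    (hbpos : ∀ u, 0 ≤ b u u)
    (hbdef : ∀ u, b u u = 0 → u = 0)
    (hbcont : ∃ C : ℝ, ∀ u v, |b u v| ≤ C * ‖u‖ * ‖v‖)
    (N : Fin p → ℝ) (hN : ∀ j, 0 < N j)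
    -- the component bilinear forms of the product metric
    (gj : Fin p → (H0 →ₗ[ℝ] H0 →ₗ[ℝ] ℝ))
    (hgsymm : ∀ j u v, gj j u v = gj j v u)
    (hgbdd : ∀ j, ∃ C : ℝ, ∀ u v, |gj j u v| ≤ C * ‖u‖ * ‖v‖)
    (hgcoer : ∀ j, ∃ c : ℝ, 0 < c ∧ ∀ u, c * ‖u‖ ^ 2 ≤ gj j u u)
    -- the inverses (G^×_{φ,j})⁻¹ applied to L²-functionals
    (Qj : Fin p → H0 → H0)
    (hQj : ∀ j (v z : H0), gj j (Qj j v) z = b v z)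
    (φ : Fin p → H0) (hφ : ∀ j, b (φ j) (φ j) = N j) :
    ∀ (u : Fin p → H0) (Pu : Fin p → H0),
      -- P^×_φ(u) = u − (G^×_φ)⁻¹(φΣ^×), Σ^× = ⟪φ,(G^×_φ)⁻¹φ⟫⁻¹⟪φ,u⟫ (component-wise)
      (Pu = fun j => u j - Qj j ((b (φ j) (u j) / b (φ j) (Qj j (φ j))) • φ j)) →
      -- tangency
      (∀ j, b (φ j) (Pu j) = 0) ∧
      -- the complement is g^×_φ-orthogonal to the tangent space
      (∀ z : Fin p → H0, (∀ j, b (φ j) (z j) = 0) →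
        ∑ j, gj j (u j - Pu j) (z j) = 0) ∧
      -- idempotency
      ((fun j => Pu j - Qj j ((b (φ j) (Pu j) / b (φ j) (Qj j (φ j))) • φ j)) = Pu) := by
  rintro u Pu rfl
  have hsmul (j : Fin p) (a : ℝ) (v : H0) : Qj j (a • v) = a • Qj j v :=
    solution_smul_of_coercive (hgcoer j) (hQj j) a v
  have hne (j : Fin p) : b (φ j) (Qj j (φ j)) ≠ 0 :=
    pairing_solution_ne_zero (hgcoer j) (hQj j) (by rw [hφ]; exact (hN j).ne')
  have htan (j : Fin p) :
      b (φ j) (u j - Qj j ((b (φ j) (u j) / b (φ j) (Qj j (φ j))) • φ j)) = 0 := by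
    rw [hsmul, map_sub, map_smul, smul_eq_mul, div_mul_cancel₀ _ (hne j), sub_self]
  refine ⟨htan, fun z hz => Finset.sum_eq_zero fun j _ => ?_, funext fun j => ?_⟩
  · rw [sub_sub_cancel, hQj, map_smul, LinearMap.smul_apply, hz, smul_zero]
  · beta_reduce
    rw [htan, zero_div, hsmul j 0, zero_smul, sub_zero]

end
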